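/- arXiv:2210.14719 — 2 statements merged into one kernel-verified Lean document; each statement's English description precedes it below -/
import Mathlib

section
/- For every folding instruction set f, S_f(4) ∈ {14, 16, 22, 24}, and consequently A_f(4) ∈ {17, 19, 25, 27}. -/
/-- A folding instruction set: a sequence with values in {-1, 1}. -/
def FoldingSeq (f : ℕ → ℤ) : Prop := ∀ s, f s = 1 ∨ f s = -1

/-- The paper-folding sequence `P_f`: if `k = 2^s * r` with `r` odd, then
`P_f[k] = f s` if `r ≡ 1 [MOD 4]` and `P_f[k] = -f s` if `r ≡ 3 [MOD 4]`. -/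
def PF (f : ℕ → ℤ) (k : ℕ) : ℤ :=
  if (k / 2 ^ (padicValNat 2 k)) % 4 = 1 then f (padicValNat 2 k)
  else -f (padicValNat 2 k)

/-- The length-`n` factors of `P_f` starting at indices `i` and `j` are identical. -/
def FactorMatch (f : ℕ → ℤ) (n i j : ℕ) : Prop :=
  ∀ t, t < n → PF f (i + t) = PF f (j + t)

/-- `Sf f n` : the least positive integer `m` such that every length-`n` factor of `P_f`
starts somewhere within the first `m` positions. -/
noncomputable def Sf (f : ℕ → ℤ) (n : ℕ) : ℕ :=
  sInf {m | 1 ≤ m ∧ ∀ i, 1 ≤ i → ∃ j, 1 ≤ j ∧ j ≤ m ∧ FactorMatch f n i j}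

/-- `Af f n` : the least positive integer `m` such that every length-`n` factor of `P_f`
appears entirely within the prefix `P_f[1..m]`. -/
noncomputable def Af (f : ℕ → ℤ) (n : ℕ) : ℕ :=
  sInf {m | 1 ≤ m ∧ ∀ i, 1 ≤ i → ∃ j, 1 ≤ j ∧ j + n - 1 ≤ m ∧ FactorMatch f n i j}

/-- `phi2 n` : the least power of 2 that is `≥ n`, i.e. `2 ^ ⌈log₂ n⌉`. -/
def phi2 (n : ℕ) : ℕ := 2 ^ Nat.clog 2 n

/-- The sign `1` or `-1` encoded by a Boolean. -/
def signOfBool (b : Bool) : ℤ := if b then 1 else -1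

theorem signOfBool_injective : Function.Injective signOfBool := by decide

/-- The Boolean encoding of `P_f[k]`, for `k` not divisible by `32`, in terms of the first five
folding instructions. -/
def foldBit (c₀ c₁ c₂ c₃ c₄ : Bool) (k : ℕ) : Bool :=
  if k % 2 = 1 then xor c₀ (k % 4 == 3)
  else if k % 4 = 2 then xor c₁ (k % 8 == 6)
  else if k % 8 = 4 then xor c₂ (k % 16 == 12)
  else if k % 16 = 8 then xor c₃ (k % 32 == 24)
  else xor c₄ (k % 64 == 48)

theorem PF_two_pow_mul (f : ℕ → ℤ) (s r : ℕ) (hr : r % 2 = 1) :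
    PF f (2 ^ s * r) = if r % 4 = 1 then f s else -f s := by
  have hv : padicValNat 2 (2 ^ s * r) = s := by
    rw [padicValNat.mul (by positivity) (by omega), padicValNat.prime_pow,
      padicValNat.eq_zero_of_not_dvd (by omega), add_zero]
  simp only [PF, hv, Nat.mul_div_cancel_left r (Nat.two_pow_pos s)]

theorem PF_eq_signOfBool (f : ℕ → ℤ) (c : ℕ → Bool) (hc : ∀ s, f s = signOfBool (c s))
    (s r k : ℕ) (hr : r % 2 = 1) (hk : k = 2 ^ s * r) :
    PF f k = signOfBool (xor (c s) (r % 4 == 3)) := by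
  subst hk
  rw [PF_two_pow_mul f s r hr, hc]
  rcases (by omega : r % 4 = 1 ∨ r % 4 = 3) with h | h <;> cases c s <;> simp [h, signOfBool]

theorem PF_eq_foldBit (f : ℕ → ℤ) (c : ℕ → Bool) (hc : ∀ s, f s = signOfBool (c s))
    (k : ℕ) (hk : k % 32 ≠ 0) :
    PF f k = signOfBool (foldBit (c 0) (c 1) (c 2) (c 3) (c 4) k) := by
  have key := PF_eq_signOfBool f c hc
  unfold foldBit
  split_ifs with h₁ h₂ h₃ h₄
  · rw [key 0 k k (by omega) (by omega)]
  · rw [key 1 (k / 2) k (by omega) (by omega),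
      show (k / 2 % 4 == 3) = (k % 8 == 6) by rw [Bool.eq_iff_iff]; simp only [beq_iff_eq]; omega]
  · rw [key 2 (k / 4) k (by omega) (by omega),
      show (k / 4 % 4 == 3) = (k % 16 == 12) by rw [Bool.eq_iff_iff]; simp only [beq_iff_eq]; omega]
  · rw [key 3 (k / 8) k (by omega) (by omega),
      show (k / 8 % 4 == 3) = (k % 32 == 24) by rw [Bool.eq_iff_iff]; simp only [beq_iff_eq]; omega]
  · rw [key 4 (k / 16) k (by omega) (by omega),
      show (k / 16 % 4 == 3) = (k % 64 == 48) by rw [Bool.eq_iff_iff]; simp only [beq_iff_eq]; omega]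

/-- A length-4 factor of a paper-folding sequence is determined by its starting index modulo `8`
and by the value `b` at its unique index divisible by `4`; all such words occur early. -/
theorem exists_foldBit_appearance (c₀ c₁ c₂ c₃ c₄ : Bool) :
    ∃ m ∈ [14, 16, 22, 24],
      (∀ r < 8, ∀ b : Bool, ∃ j < m, ∀ t < 4,
        (if (r + t) % 4 = 0 then b else foldBit c₀ c₁ c₂ c₃ c₄ (r + t)) =
          foldBit c₀ c₁ c₂ c₃ c₄ (j + 1 + t)) ∧
      ∀ j < m - 1, ∃ t < 4,
        foldBit c₀ c₁ c₂ c₃ c₄ (m + t) ≠ foldBit c₀ c₁ c₂ c₃ c₄ (j + 1 + t) := by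
  revert c₀ c₁ c₂ c₃ c₄
  decide +kernel

theorem exists_isLeast_factorMatch_four (f : ℕ → ℤ) (hf : FoldingSeq f) :
    ∃ m ∈ [14, 16, 22, 24], (∀ i, 1 ≤ i → ∃ j, 1 ≤ j ∧ j ≤ m ∧ FactorMatch f 4 i j) ∧
      ∀ j, 1 ≤ j → FactorMatch f 4 m j → m ≤ j := by
  obtain ⟨c, hc⟩ : ∃ c : ℕ → Bool, ∀ s, f s = signOfBool (c s) :=
    ⟨fun s => decide (f s = 1), fun s => by rcases hf s with h | h <;> simp [h, signOfBool]⟩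
  have hPF := PF_eq_foldBit f c hc
  obtain ⟨m, hm, hupper, hlower⟩ := exists_foldBit_appearance (c 0) (c 1) (c 2) (c 3) (c 4)
  have hm24 : 14 ≤ m ∧ m ≤ 24 := by
    simp only [List.mem_cons, List.not_mem_nil, or_false] at hm
    omega
  refine ⟨m, hm, fun i hi => ?_, fun j hj hmatch => ?_⟩
  · obtain ⟨b, hb⟩ : ∃ b, PF f (4 * ((i + 3) / 4)) = signOfBool b := by
      unfold PF
      split_ifs
      · exact ⟨_, hc _⟩
      · exact ⟨!c (padicValNat 2 (4 * ((i + 3) / 4))), by rw [hc]; cases c _ <;> rfl⟩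
    obtain ⟨j, hjm, hj⟩ := hupper (i % 8) (Nat.mod_lt _ (by norm_num)) b
    refine ⟨j + 1, by omega, by omega, fun t ht => ?_⟩
    rw [hPF (j + 1 + t) (by omega), ← hj t ht]
    split_ifs with h
    · rw [← hb]
      congr 1
      omega
    · rw [hPF (i + t) (by omega)]
      congr 1
      have h₂ : (i % 8 + t) % 2 = (i + t) % 2 := by omega
      have h₄ : (i % 8 + t) % 4 = (i + t) % 4 := by omega
      have h₈ : (i % 8 + t) % 8 = (i + t) % 8 := by omega
      unfold foldBit
      rw [h₂, h₄, h₈]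
      split_ifs <;> first | rfl | omega
  · by_contra! hlt
    obtain ⟨t, ht, hne⟩ := hlower (j - 1) (by omega)
    apply hne
    apply signOfBool_injective
    rw [Nat.sub_add_cancel hj, ← hPF _ (by omega), ← hPF _ (by omega)]
    exact hmatch t ht

theorem stmt11 (f : ℕ → ℤ) (hf : FoldingSeq f) :
    Sf f 4 ∈ ({14, 16, 22, 24} : Set ℕ) ∧ Af f 4 ∈ ({17, 19, 25, 27} : Set ℕ) := by
  obtain ⟨m, hm, hupper, hlower⟩ := exists_isLeast_factorMatch_four f hf
  simp only [List.mem_cons, List.not_mem_nil, or_false] at hm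
  have hS : Sf f 4 = m := by
    refine IsLeast.csInf_eq ⟨⟨by omega, hupper⟩, fun n hn => ?_⟩
    obtain ⟨j, hj, hjn, hmatch⟩ := hn.2 m (by omega)
    exact (hlower j hj hmatch).trans hjn
  have hA : Af f 4 = m + 3 := by
    refine IsLeast.csInf_eq ⟨⟨by omega, fun i hi => ?_⟩, fun n hn => ?_⟩
    · obtain ⟨j, hj, hjm, hmatch⟩ := hupper i hi
      exact ⟨j, hj, by omega, hmatch⟩
    · obtain ⟨j, hj, hjn, hmatch⟩ := hn.2 m (by omega)
      have := hlower j hj hmatch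
      omega
  simp only [hS, hA, Set.mem_insert_iff, Set.mem_singleton_iff]
  omega
end

section
/- For every folding instruction set f, S_f(5) ∈ {28, 32, 44, 48}, and consequently A_f(5) ∈ {32, 36, 48, 52}. -/
theorem PF_two_mul (f : ℕ → ℤ) {k : ℕ} (hk : k ≠ 0) :
    PF f (2 * k) = PF (fun s => f (s + 1)) k := by
  have h : padicValNat 2 (2 * k) = padicValNat 2 k + 1 := by
    rw [padicValNat.mul two_ne_zero hk, padicValNat_self, add_comm]
  simp only [PF, h, pow_succ', Nat.mul_div_mul_left _ _ two_pos]

theorem PF_of_odd (f : ℕ → ℤ) {k : ℕ} (hk : k % 2 = 1) :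
    PF f k = if k % 4 = 1 then f 0 else -f 0 := by
  have h : padicValNat 2 k = 0 := padicValNat.eq_zero_of_not_dvd (by omega)
  simp [PF, h]

theorem FoldingSeq.PF_eq {f : ℕ → ℤ} (hf : FoldingSeq f) (k : ℕ) :
    PF f k = 1 ∨ PF f k = -1 := by
  unfold PF
  rcases hf (padicValNat 2 k) with h | h <;> rw [h] <;> split_ifs <;> simp

/-- The value of `P_f` at an index not divisible by `2 ^ n` depends only on the index
modulo `2 ^ (n + 1)`. -/
theorem PF_congr_mod (n : ℕ) (f : ℕ → ℤ) {k l : ℕ} (hk : k % 2 ^ n ≠ 0)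
    (hkl : k % 2 ^ (n + 1) = l % 2 ^ (n + 1)) : PF f k = PF f l := by
  induction n generalizing f k l with
  | zero => simp [Nat.mod_one] at hk
  | succ n ih =>
    have h4 : k % 4 = l % 4 := by
      have hd : 4 ∣ 2 ^ (n + 1 + 1) := ⟨2 ^ n, by ring⟩
      rw [← Nat.mod_mod_of_dvd k hd, hkl, Nat.mod_mod_of_dvd l hd]
    rcases Nat.mod_two_eq_zero_or_one k with h | h
    · obtain ⟨a, rfl⟩ : ∃ a, k = 2 * a := ⟨k / 2, by omega⟩
      obtain ⟨b, rfl⟩ : ∃ b, l = 2 * b := ⟨l / 2, by omega⟩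
      rw [pow_succ' 2 n, Nat.mul_mod_mul_left] at hk
      rw [pow_succ' 2 (n + 1), Nat.mul_mod_mul_left, Nat.mul_mod_mul_left] at hkl
      have ha : a % 2 ^ n ≠ 0 := fun h => hk (by rw [h])
      have hab : a % 2 ^ (n + 1) = b % 2 ^ (n + 1) := by omega
      have hb : b ≠ 0 := by
        rintro rfl
        apply ha
        rw [← Nat.mod_mod_of_dvd a (pow_dvd_pow 2 n.le_succ), hab]
        simp
      have ha0 : a ≠ 0 := by
        rintro rfl
        exact ha (Nat.zero_mod _)
      rw [PF_two_mul f ha0, PF_two_mul f hb, ih _ ha hab]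
    · rw [PF_of_odd f h, PF_of_odd f (by omega), h4]

theorem PF_forty_eight (f : ℕ → ℤ) : PF f 48 = -PF f 16 := by
  rw [show 48 = 2 * (2 * (2 * (2 * 3))) by norm_num,
    show 16 = 2 * (2 * (2 * (2 * 1))) by norm_num]
  iterate 8 rw [PF_two_mul _ (by norm_num)]
  rw [PF_of_odd _ (by norm_num), PF_of_odd _ (by norm_num)]
  simp

/-- Every factor of length `5` occurs at one of the first `48` positions. -/
theorem FoldingSeq.exists_factorMatch_le {f : ℕ → ℤ} (hf : FoldingSeq f) (i : ℕ) :
    ∃ j, 1 ≤ j ∧ j ≤ 48 ∧ FactorMatch f 5 i j := by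
  by_cases h : ∃ c < 5, (i + c) % 16 = 0
  · obtain ⟨c, hc, h⟩ := h
    obtain ⟨p, hp, hpi⟩ : ∃ p, (p = 16 ∨ p = 48) ∧ PF f (i + c) = PF f p := by
      rcases hf.PF_eq (i + c) with h1 | h1 <;> rcases hf.PF_eq 16 with h2 | h2
      · exact ⟨16, by simp, by rw [h1, h2]⟩
      · exact ⟨48, by simp, by rw [PF_forty_eight, h1, h2, neg_neg]⟩
      · exact ⟨48, by simp, by rw [PF_forty_eight, h1, h2]⟩
      · exact ⟨16, by simp, by rw [h1, h2]⟩
    refine ⟨p - c, by omega, by omega, fun t ht => ?_⟩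
    rcases eq_or_ne t c with rfl | htc
    · rw [hpi, Nat.sub_add_cancel (by omega)]
    · exact PF_congr_mod 3 f (by omega) (by omega)
  · push Not at h
    have h0 := h 0 (by norm_num)
    refine ⟨i % 32, by omega, by omega, fun t ht => ?_⟩
    exact PF_congr_mod 4 f (h t ht) (by omega)

/-- The paper-folding sequence computed from a list of Boolean instructions. -/
def foldBool : List Bool → ℕ → Bool
  | [], _ => false
  | b :: l, k => if k % 2 = 0 then foldBool l (k / 2) else b == decide (k % 4 = 1)

theorem foldBool_map_range {f : ℕ → ℤ} (hf : FoldingSeq f) (n : ℕ) {k : ℕ} (hk : k ≠ 0)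
    (hkn : k < 2 ^ n) :
    foldBool ((List.range n).map fun s => decide (f s = 1)) k = decide (PF f k = 1) := by
  induction n generalizing f k with
  | zero => omega
  | succ n ih =>
    rw [List.range_succ_eq_map, List.map_cons, List.map_map, foldBool]
    split_ifs with h
    · obtain ⟨a, rfl⟩ : ∃ a, k = 2 * a := ⟨k / 2, by omega⟩
      rw [PF_two_mul f (by omega), Nat.mul_div_cancel_left _ two_pos,
        ← ih (fun s => hf (s + 1)) (by omega) (by rw [pow_succ] at hkn; omega)]
      rfl
    · rw [PF_of_odd f (by omega)]
      rcases hf 0 with h0 | h0 <;> by_cases h4 : k % 4 = 1 <;> simp [h0, h4]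

/-- The Boolean counterpart of `FactorMatch` for factors of length `5`. -/
def boolMatch (l : List Bool) (i j : ℕ) : Bool :=
  (List.range 5).all fun t => foldBool l (i + t) == foldBool l (j + t)

theorem boolMatch_iff {f : ℕ → ℤ} (hf : FoldingSeq f) {n i j : ℕ} (hi : 1 ≤ i) (hj : 1 ≤ j)
    (hin : i + 4 < 2 ^ n) (hjn : j + 4 < 2 ^ n) :
    boolMatch ((List.range n).map fun s => decide (f s = 1)) i j = true ↔
      FactorMatch f 5 i j := by
  simp only [boolMatch, List.all_eq_true, List.mem_range, beq_iff_eq, FactorMatch]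
  refine forall₂_congr fun t ht => ?_
  rw [foldBool_map_range hf n (by omega) (by omega),
    foldBool_map_range hf n (by omega) (by omega), decide_eq_decide]
  rcases hf.PF_eq (i + t) with h1 | h1 <;> rcases hf.PF_eq (j + t) with h2 | h2 <;>
    simp [h1, h2]

/-- Among the first `48` positions, the last one at which a new factor of length `5` occurs is
`28`, `32`, `44` or `48`. -/
theorem exists_last_new_factor (b₀ b₁ b₂ b₃ b₄ b₅ : Bool) :
    ∃ m ∈ [28, 32, 44, 48],
      (∀ d < 48 - m, ∃ e < m, boolMatch [b₀, b₁, b₂, b₃, b₄, b₅] (m + 1 + d) (e + 1) = true) ∧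
      ∀ e < m - 1, boolMatch [b₀, b₁, b₂, b₃, b₄, b₅] m (e + 1) = false := by
  revert b₀ b₁ b₂ b₃ b₄ b₅
  decide +kernel

theorem FoldingSeq.exists_first_occurrence {f : ℕ → ℤ} (hf : FoldingSeq f) :
    ∃ m ∈ [28, 32, 44, 48],
      (∀ i, 1 ≤ i → ∃ j, 1 ≤ j ∧ j ≤ m ∧ FactorMatch f 5 i j) ∧
      ∀ j, 1 ≤ j → FactorMatch f 5 m j → m ≤ j := by
  obtain ⟨m, hm, hup, hlow⟩ := exists_last_new_factor (decide (f 0 = 1)) (decide (f 1 = 1))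
    (decide (f 2 = 1)) (decide (f 3 = 1)) (decide (f 4 = 1)) (decide (f 5 = 1))
  have hm' : 28 ≤ m ∧ m ≤ 48 := by
    simp only [List.mem_cons, List.not_mem_nil, or_false] at hm
    omega
  refine ⟨m, hm, fun i hi => ?_, fun j hj hmj => ?_⟩
  · obtain ⟨j, hj, hj48, hij⟩ := hf.exists_factorMatch_le i
    by_cases hjm : j ≤ m
    · exact ⟨j, hj, hjm, hij⟩
    · obtain ⟨e, he, hje⟩ := hup (j - (m + 1)) (by omega)
      rw [Nat.add_sub_cancel' (by omega)] at hje
      have hmatch := (boolMatch_iff hf (n := 6) hj (by omega) (by omega) (by omega)).1 hje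
      exact ⟨e + 1, by omega, by omega, fun t ht => (hij t ht).trans (hmatch t ht)⟩
  · by_contra! hlt
    have h := hlow (j - 1) (by omega)
    rw [Nat.sub_add_cancel hj] at h
    have h' := (boolMatch_iff hf (n := 6) (by omega) hj (by omega) (by omega)).2 hmj
    exact Bool.false_ne_true (h.symm.trans h')

theorem Sf_eq {f : ℕ → ℤ} {n m : ℕ} (hm : 1 ≤ m)
    (hup : ∀ i, 1 ≤ i → ∃ j, 1 ≤ j ∧ j ≤ m ∧ FactorMatch f n i j)
    (hlow : ∀ j, 1 ≤ j → FactorMatch f n m j → m ≤ j) : Sf f n = m := by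
  refine IsLeast.csInf_eq ⟨⟨hm, hup⟩, fun m' hm' => ?_⟩
  obtain ⟨j, hj, hjm, hmj⟩ := hm'.2 m hm
  exact (hlow j hj hmj).trans hjm

theorem Af_eq {f : ℕ → ℤ} {n m : ℕ} (hm : 1 ≤ m)
    (hup : ∀ i, 1 ≤ i → ∃ j, 1 ≤ j ∧ j ≤ m ∧ FactorMatch f n i j)
    (hlow : ∀ j, 1 ≤ j → FactorMatch f n m j → m ≤ j) (hn : 1 ≤ n) :
    Af f n = m + n - 1 := by
  refine IsLeast.csInf_eq ⟨⟨by omega, fun i hi => ?_⟩, fun m' hm' => ?_⟩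
  · obtain ⟨j, hj, hjm, hij⟩ := hup i hi
    exact ⟨j, hj, by omega, hij⟩
  · obtain ⟨j, hj, hjm, hmj⟩ := hm'.2 m hm
    have := hlow j hj hmj
    omega

theorem stmt12 (f : ℕ → ℤ) (hf : FoldingSeq f) :
    Sf f 5 ∈ ({28, 32, 44, 48} : Set ℕ) ∧ Af f 5 ∈ ({32, 36, 48, 52} : Set ℕ) := by
  obtain ⟨m, hm, hup, hlow⟩ := hf.exists_first_occurrence
  simp only [List.mem_cons, List.not_mem_nil, or_false] at hm
  have hm1 : 1 ≤ m := by omega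
  rw [Sf_eq hm1 hup hlow, Af_eq hm1 hup hlow (by norm_num)]
  simp only [Set.mem_insert_iff, Set.mem_singleton_iff]
  omega
end
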